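/- Let α > 0, η > 2, and k ≥ 1. For every j ∈ {1,…,k} there exists t_j ∈ ℕ (depending only on α, η, k, and j) such that: for every reward table X : ℕ → Fin k → [-1,1] and every pull sequence consistent with the α-UCB policy applied to X, for all t ≥ t_j, at least j distinct arms i satisfy N_i^{t−1} ≥ α·ln t/(2η²j²). -/

import Mathlib

namespace Freeride

variable {k : ℕ}

/-- Number of times arm `i` is pulled in rounds `1, …, t` by the pull sequence `I`. -/
def nCount (I : ℕ → Fin k) (i : Fin k) (t : ℕ) : ℕ :=
  ((Finset.Icc 1 t).filter fun s => I s = i).card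

/-- Sample mean of arm `i` over rounds `1, …, t`, given reward table `X` and pulls `I`. -/
noncomputable def sampleMean (X : ℕ → Fin k → ℝ) (I : ℕ → Fin k) (i : Fin k) (t : ℕ) : ℝ :=
  (∑ s ∈ (Finset.Icc 1 t).filter fun s => I s = i, X s i) / nCount I i t

/-- The `α`-UCB index of arm `i` after round `t` (`⊤` for unpulled arms). -/
noncomputable def ucbVal (α : ℝ) (X : ℕ → Fin k → ℝ) (I : ℕ → Fin k) (i : Fin k) (t : ℕ) :
    EReal :=
  if nCount I i t = 0 then ⊤
  else ((sampleMean X I i t +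
    Real.sqrt (α * Real.log (t + 1) / (2 * nCount I i t)) : ℝ) : EReal)

/-- The pull sequence `I` is consistent with the `α`-UCB policy on reward table `X`:
the arm pulled in round `t+1` maximizes the `α`-UCB index after round `t`. -/
def IsUCB (α : ℝ) (X : ℕ → Fin k → ℝ) (I : ℕ → Fin k) : Prop :=
  ∀ t : ℕ, ∀ j : Fin k, ucbVal α X I j t ≤ ucbVal α X I (I (t + 1)) t

lemma nCount_mono (I : ℕ → Fin k) (i : Fin k) : Monotone (nCount I i) := fun _ _ h =>
  Finset.card_le_card (Finset.filter_subset_filter _ (Finset.Icc_subset_Icc_right h))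

lemma abs_sampleMean_le_one {X : ℕ → Fin k → ℝ} (hX : ∀ t i, X t i ∈ Set.Icc (-1 : ℝ) 1)
    (I : ℕ → Fin k) (i : Fin k) (t : ℕ) : |sampleMean X I i t| ≤ 1 := by
  unfold sampleMean
  rw [abs_div, Nat.abs_cast]
  refine div_le_one_of_le₀ ?_ (Nat.cast_nonneg _)
  refine (Finset.abs_sum_le_sum_abs _ _).trans ?_
  refine (Finset.sum_le_card_nsmul _ _ 1 fun s _ => abs_le.2 (hX s i)).trans ?_
  simp [nCount]

/-- If some arm `l` has an exploration bonus of at least `β > 2` before round `s + 1`, then the arm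
pulled in round `s + 1` has a bonus of at least `β - 2`, which bounds its sample count. -/
lemma IsUCB.nCount_le {α β : ℝ} {X : ℕ → Fin k → ℝ}
    (hX : ∀ t i, X t i ∈ Set.Icc (-1 : ℝ) 1) {I : ℕ → Fin k} (hI : IsUCB α X I) (hβ : 2 < β)
    {s : ℕ} {l : Fin k} (hl : β ^ 2 * (2 * nCount I l s) ≤ α * Real.log (s + 1))
    (hlog : 0 ≤ α * Real.log (s + 1)) :
    (nCount I (I (s + 1)) s : ℝ) ≤ α * Real.log (s + 1) / (2 * (β - 2) ^ 2) := by
  have hg : 0 < β - 2 := by linarith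
  rcases Nat.eq_zero_or_pos (nCount I (I (s + 1)) s) with h0 | hpos
  · rw [h0, Nat.cast_zero]
    positivity
  have hucb := hI s l
  unfold ucbVal at hucb
  rw [if_neg hpos.ne'] at hucb
  by_cases hl0 : nCount I l s = 0
  · rw [if_pos hl0] at hucb
    exact absurd (top_le_iff.1 hucb) (EReal.coe_ne_top _)
  rw [if_neg hl0, EReal.coe_le_coe_iff] at hucb
  have hl1 : (0 : ℝ) < nCount I l s := by exact_mod_cast Nat.pos_of_ne_zero hl0
  have hi1 : (0 : ℝ) < nCount I (I (s + 1)) s := by exact_mod_cast hpos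
  have hbonus : β ≤ √(α * Real.log (s + 1) / (2 * nCount I l s)) :=
    Real.le_sqrt_of_sq_le ((le_div_iff₀ (by positivity)).2 hl)
  have h1 := abs_le.1 (abs_sampleMean_le_one hX I l s)
  have h2 := abs_le.1 (abs_sampleMean_le_one hX I (I (s + 1)) s)
  have h3 : β - 2 ≤ √(α * Real.log (s + 1) / (2 * nCount I (I (s + 1)) s)) := by linarith
  rw [Real.le_sqrt' hg, le_div_iff₀ (by positivity)] at h3
  rw [le_div_iff₀ (by positivity)]
  linarith

/-- If an arm is pulled in rounds of `[m, n]` only when its sample count is at most `D`, then it is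
pulled at most `D + 1` times in that window. -/
lemma card_window_le {I : ℕ → Fin k} {i : Fin k} {m n : ℕ} {D : ℝ} (hD : 0 ≤ D) (hm : 1 ≤ m)
    (h : ∀ s, m ≤ s + 1 → s + 1 ≤ n → I (s + 1) = i → (nCount I i s : ℝ) ≤ D) :
    (((Finset.Icc m n).filter fun s => I s = i).card : ℝ) ≤ D + 1 := by
  set W := (Finset.Icc m n).filter fun s => I s = i with hW
  rcases W.eq_empty_or_nonempty with h0 | hne
  · rw [h0, Finset.card_empty, Nat.cast_zero]
    linarith
  have hmem := W.max'_mem hne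
  obtain ⟨s, hs⟩ : ∃ s, W.max' hne = s + 1 := by
    have := (Finset.mem_Icc.1 (Finset.mem_filter.1 hmem).1).1
    exact Nat.exists_eq_succ_of_ne_zero (by omega)
  rw [hs] at hmem
  obtain ⟨hr, hi⟩ := Finset.mem_filter.1 hmem
  have hsub : W ⊆ insert (s + 1) ((Finset.Icc 1 s).filter fun s => I s = i) := by
    intro x hx
    have hle := W.le_max' x hx
    rw [hs] at hle
    simp only [hW, Finset.mem_filter, Finset.mem_Icc] at hx
    simp only [Finset.mem_insert, Finset.mem_filter, Finset.mem_Icc]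
    rcases hle.eq_or_lt with h | h
    · exact Or.inl h
    · exact Or.inr ⟨by omega, hx.2⟩
  have hcard : W.card ≤ nCount I i s + 1 :=
    (Finset.card_le_card hsub).trans (Finset.card_insert_le _ _)
  have hcount := h s (Finset.mem_Icc.1 hr).1 (Finset.mem_Icc.1 hr).2 hi
  have hcard' : (W.card : ℝ) ≤ nCount I i s + 1 := by exact_mod_cast hcard
  linarith

lemma eventually_mul_log_add_lt (a b : ℝ) :
    ∀ᶠ t : ℕ in Filter.atTop, a * Real.log t + b < (t : ℝ) / 2 := by
  have h1 : (fun x : ℝ => a * Real.log x + b) =o[Filter.atTop] (id : ℝ → ℝ) :=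
    (Real.isLittleO_log_id_atTop.const_mul_left a).add
      (Asymptotics.isLittleO_const_id_atTop b)
  have h2 := (h1.def (c := 1 / 4) (by norm_num)).and (Filter.eventually_gt_atTop (0 : ℝ))
  filter_upwards [tendsto_natCast_atTop_atTop.eventually h2] with t ht
  have := (le_abs_self _).trans ht.1
  simp only [id, Real.norm_eq_abs, abs_of_pos ht.2] at this
  linarith [ht.2]

/-- Under `α`-UCB with rewards in `[-1, 1]`, every arm is eventually sampled at a logarithmic rate,
uniformly over reward tables and consistent pull sequences. -/
theorem exists_forall_log_le_nCount {α η : ℝ} (hα : 0 < α) (hη : 2 < η) (k : ℕ) :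
    ∃ T : ℕ, ∀ X : ℕ → Fin k → ℝ, (∀ t i, X t i ∈ Set.Icc (-1 : ℝ) 1) →
      ∀ I : ℕ → Fin k, IsUCB α X I → ∀ t : ℕ, T ≤ t → ∀ l : Fin k,
        α * Real.log t / (2 * η ^ 2) ≤ (nCount I l (t - 1) : ℝ) := by
  obtain ⟨β, hβ, hβη⟩ := exists_between hη
  have hgap : 0 < η ^ 2 - β ^ 2 := by nlinarith
  have hlog : ∀ᶠ t : ℕ in Filter.atTop, η ^ 2 * Real.log 2 / (η ^ 2 - β ^ 2) ≤ Real.log t :=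
    (Real.tendsto_log_atTop.comp tendsto_natCast_atTop_atTop).eventually_ge_atTop _
  obtain ⟨T, hT⟩ := Filter.eventually_atTop.1 (hlog.and
    ((eventually_mul_log_add_lt (k * (α / (2 * (β - 2) ^ 2))) (k + 1)).and
      (Filter.eventually_ge_atTop 1)))
  refine ⟨T, fun X hX I hI t ht l => ?_⟩
  obtain ⟨hlogt, hlin, ht1⟩ := hT t ht
  rw [div_le_iff₀ hgap] at hlogt
  have hg : 0 < β - 2 := by linarith
  have ht0 : (1 : ℝ) ≤ t := by exact_mod_cast ht1
  have hlt0 : 0 ≤ Real.log t := Real.log_nonneg ht0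
  by_contra! hlow
  rw [lt_div_iff₀ (by positivity)] at hlow
  set D := α * Real.log t / (2 * (β - 2) ^ 2) with hD
  have hwindow (i : Fin k) :
      (((Finset.Icc (t / 2 + 1) (t - 1)).filter fun s => I s = i).card : ℝ) ≤ D + 1 := by
    refine card_window_le (by positivity) (by omega) fun s hs1 hs2 hi => ?_
    have hs_half : (t : ℝ) / 2 ≤ s + 1 := by
      have : (t : ℝ) ≤ 2 * (s + 1) := by exact_mod_cast (by omega : t ≤ 2 * (s + 1))
      linarith
    have hs_le : (s : ℝ) + 1 ≤ t := by exact_mod_cast (by omega : s + 1 ≤ t)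
    have hlog1 : Real.log t - Real.log 2 ≤ Real.log (s + 1) := by
      rw [← Real.log_div (by positivity) two_ne_zero]
      exact Real.log_le_log (by positivity) hs_half
    have hlog2 : Real.log (s + 1) ≤ Real.log t := Real.log_le_log (by positivity) hs_le
    have hlog3 : 0 ≤ Real.log ((s : ℝ) + 1) :=
      Real.log_nonneg (by linarith [s.cast_nonneg (α := ℝ)])
    have hratio : β ^ 2 * Real.log t ≤ η ^ 2 * Real.log (s + 1) := by
      nlinarith [mul_le_mul_of_nonneg_left hlog1 (sq_nonneg η)]
    have hmono : (nCount I l s : ℝ) ≤ nCount I l (t - 1) := by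
      exact_mod_cast nCount_mono I l (by omega : s ≤ t - 1)
    have hl : β ^ 2 * (2 * nCount I l s) ≤ α * Real.log (s + 1) := by
      have hη2 : 0 < η ^ 2 := by positivity
      refine le_of_mul_le_mul_left ?_ hη2
      calc η ^ 2 * (β ^ 2 * (2 * nCount I l s))
          = β ^ 2 * (nCount I l s * (2 * η ^ 2)) := by ring
        _ ≤ β ^ 2 * (nCount I l (t - 1) * (2 * η ^ 2)) := by gcongr
        _ ≤ β ^ 2 * (α * Real.log t) := by gcongr
        _ = α * (β ^ 2 * Real.log t) := by ring
        _ ≤ α * (η ^ 2 * Real.log (s + 1)) := by gcongr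
        _ = η ^ 2 * (α * Real.log (s + 1)) := by ring
    rw [← hi]
    refine (hI.nCount_le hX hβ hl (by positivity)).trans ?_
    rw [hD]
    gcongr
  have htotal : ((Finset.Icc (t / 2 + 1) (t - 1)).card : ℝ) ≤ k * (D + 1) := by
    rw [Finset.card_eq_sum_card_fiberwise (f := I) (t := Finset.univ) (by simp), Nat.cast_sum]
    refine (Finset.sum_le_sum fun i _ => hwindow i).trans ?_
    simp [mul_add]
  have hcard : (t : ℝ) ≤ 2 * ((Finset.Icc (t / 2 + 1) (t - 1)).card + 1) := by
    rw [Nat.card_Icc]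
    exact_mod_cast (by omega : t ≤ 2 * (t - 1 + 1 - (t / 2 + 1) + 1))
  have hexpand : k * (D + 1) = k * (α / (2 * (β - 2) ^ 2)) * Real.log t + k := by
    rw [hD]
    ring
  linarith

/-- For a player following `α`-UCB, for each `j ∈ {1,…,k}` there is a
time `t_j` after which at least `j` distinct arms have been pulled at least
`α ln t / (2 η² j²)` times by round `t - 1`. -/
theorem statement14 (α η : ℝ) (hα : 0 < α) (hη : 2 < η) (k : ℕ) (hk : 1 ≤ k) :
    ∀ j : ℕ, 1 ≤ j → j ≤ k →
      ∃ tj : ℕ, ∀ X : ℕ → Fin k → ℝ, (∀ t i, X t i ∈ Set.Icc (-1 : ℝ) 1) →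
        ∀ I : ℕ → Fin k, IsUCB α X I →
          ∀ t : ℕ, tj ≤ t →
            j ≤ (Finset.univ.filter fun i : Fin k =>
              α * Real.log t / (2 * η ^ 2 * (j : ℝ) ^ 2) ≤ (nCount I i (t - 1) : ℝ)).card := by
  intro j hj hjk
  obtain ⟨T, hT⟩ := exists_forall_log_le_nCount hα hη k
  refine ⟨T, fun X hX I hI t ht => ?_⟩
  rw [Finset.filter_true_of_mem fun i _ => ?_]
  · simpa using hjk
  · refine le_trans ?_ (hT X hX I hI t ht i)
    have hj' : (1 : ℝ) ≤ j := by exact_mod_cast hj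
    have := Real.log_natCast_nonneg t
    gcongr α * Real.log t / ?_
    exact le_mul_of_one_le_right (by positivity) (one_le_pow₀ hj')

end Freeride
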